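/- arXiv:1605.01488 — 4 statements merged into one kernel-verified Lean document; each statement's English description precedes it below -/
import Mathlib

section
/- Let n ≥ 2 and let d : {1,…,n} → {0,1} satisfy the four locally consistent parsing conditions: d(1)=1; d(n)=0; d(i)+d(i+1) ≤ 1 for all 1 ≤ i < n; and d(i)+d(i+1)+d(i+2)+d(i+3) ≥ 1 for all 1 ≤ i ≤ n−3. Let 1 = i₁ < i₂ < ⋯ < i_j be exactly the positions where d equals 1. Then for every 1 ≤ k < j one has 2 ≤ i_{k+1} − i_k ≤ 4, and moreover 2 ≤ n − i_j + 1 ≤ 4. Consequently the intervals [i₁, i₂−1], [i₂, i₃−1], …, [i_j, n] partition {1,…,n} into consecutive blocks, each of length at least 2 and at most 4. -/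
/-- Let `n ≥ 2` and let `d : {1,…,n} → {0,1}` satisfy the four locally
consistent parsing conditions.  Then consecutive positions carrying bit `1` are at distance
between 2 and 4, and the last `1`-position `i` satisfies `2 ≤ n − i + 1 ≤ 4`; hence the blocks
cut before each `1`-position have length from two to four. -/
theorem locally_consistent_blocks_length_two_to_four
    (n : ℕ) (hn : 2 ≤ n) (d : ℕ → ℕ)
    (hbit : ∀ i, 1 ≤ i → i ≤ n → d i ≤ 1)
    (h1 : d 1 = 1) (hlast : d n = 0)
    (hno2 : ∀ i, 1 ≤ i → i < n → d i + d (i + 1) ≤ 1)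
    (hgap : ∀ i, 1 ≤ i → i + 3 ≤ n → 1 ≤ d i + d (i + 1) + d (i + 2) + d (i + 3)) :
    (∀ a b, 1 ≤ a → a < b → b ≤ n → d a = 1 → d b = 1 →
        (∀ c, a < c → c < b → d c = 0) → 2 ≤ b - a ∧ b - a ≤ 4) ∧
    (∀ a, 1 ≤ a → a ≤ n → d a = 1 →
        (∀ c, a < c → c ≤ n → d c = 0) → 2 ≤ n - a + 1 ∧ n - a + 1 ≤ 4) := by
  refine ⟨fun a b ha hab hb hda hdb hzero => ⟨?_, ?_⟩, fun a ha han hda hzero => ⟨?_, ?_⟩⟩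
  · by_contra h
    obtain rfl : b = a + 1 := by omega
    have := hno2 a ha (by omega)
    omega
  · by_contra h
    have := hgap (a + 1) (by omega) (by omega)
    have := hzero (a + 1) (by omega) (by omega)
    have := hzero (a + 1 + 1) (by omega) (by omega)
    have := hzero (a + 1 + 2) (by omega) (by omega)
    have := hzero (a + 1 + 3) (by omega) (by omega)
    omega
  · by_contra h
    obtain rfl : a = n := by omega
    omega
  · by_contra h
    have := hgap (a + 1) (by omega) (by omega)
    have := hzero (a + 1) (by omega) (by omega)
    have := hzero (a + 1 + 1) (by omega) (by omega)
    have := hzero (a + 1 + 2) (by omega) (by omega)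
    have := hzero (a + 1 + 3) (by omega) (by omega)
    omega
end

section
/- For every positive integer W there exists a function f : [0..W]^{log* W + 11} → {0,1} such that for every n ≥ 2 and every sequence p : {1,…,n} → {1,…,W} with p(i) ≠ p(i+1) for all 1 ≤ i < n, the bit sequence d defined by d(i) = f(p̃(i−Δ_L), …, p̃(i+Δ_R)) for 1 ≤ i ≤ n—where Δ_L = log* W + 6, Δ_R = 4, and p̃(m) = p(m) for 1 ≤ m ≤ n and p̃(m) = 0 otherwise—satisfies: d(1) = 1; d(n) = 0; d(i) + d(i+1) ≤ 1 for all 1 ≤ i < n; and d(i) + d(i+1) + d(i+2) + d(i+3) ≥ 1 for all 1 ≤ i ≤ n−3. -/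
/-- The iterated base-2 logarithm: the least number of applications of the floor base-2
logarithm needed to bring `W` down to a value at most `1`. -/
def logStar (W : ℕ) : ℕ :=
  if h : W ≤ 1 then 0 else logStar (Nat.log 2 W) + 1
decreasing_by
  exact Nat.log_lt_self 2 (by omega)

/-- Twice the least binary position at which `a` and `b` differ, plus the bit of `b` there
(the parity of `b` if `a = b`). -/
def coleVishkin (a b : ℕ) : ℕ :=
  if h : a % 2 ≠ b % 2 ∨ a = b then b % 2 else coleVishkin (a / 2) (b / 2) + 2
termination_by a + b
decreasing_by omega

theorem coleVishkin_ne (a b c : ℕ) (h : b ≠ c) : coleVishkin a b ≠ coleVishkin b c := by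
  induction a, b using coleVishkin.induct generalizing c with
  | case1 a b hab =>
    rw [coleVishkin, dif_pos hab, coleVishkin]
    split_ifs <;> omega
  | case2 a b hab ih =>
    rw [coleVishkin, dif_neg hab, coleVishkin.eq_1 b c]
    split_ifs with hbc
    · omega
    · have := ih (c / 2) (by omega)
      omega

theorem coleVishkin_le (a b W : ℕ) (ha : a ≤ W) (hb : b ≤ W) :
    coleVishkin a b ≤ 2 * Nat.log 2 W + 1 := by
  induction a, b using coleVishkin.induct generalizing W with
  | case1 a b hab =>
    rw [coleVishkin, dif_pos hab]
    omega
  | case2 a b hab ih =>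
    rw [coleVishkin, dif_neg hab, Nat.log_of_one_lt_of_le one_lt_two (by omega : 2 ≤ W)]
    have := ih (W / 2) (by omega) (by omega)
    omega

/-- One round of color reduction, comparing each entry with its left neighbor. -/
def reduceColors (a : ℤ → ℕ) (i : ℤ) : ℕ := coleVishkin (a (i - 1)) (a i)

theorem reduceColors_iterate_le (W : ℕ) (hW : 1 ≤ W) (a : ℤ → ℕ) (ha : ∀ i, a i ≤ 2 * W + 5)
    (i : ℤ) : (reduceColors^[logStar W] a) i ≤ 7 := by
  induction W using logStar.induct generalizing a with
  | case1 W h =>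
    rw [logStar, dif_pos h]
    exact (ha i).trans (by omega)
  | case2 W h ih =>
    rw [logStar, dif_neg h, Function.iterate_succ_apply]
    refine ih (Nat.log_pos one_lt_two (by omega)) _ fun j => ?_
    have hlog : Nat.log 2 (2 * W + 5) < Nat.log 2 W + 3 := by
      refine Nat.log_lt_of_lt_pow (by omega) ?_
      have h1 : W < 2 ^ (Nat.log 2 W + 1) := Nat.lt_pow_succ_log_self one_lt_two W
      have h2 : 0 < 2 ^ Nat.log 2 W := by positivity
      rw [pow_succ] at h1
      rw [pow_add]
      omega
    have := coleVishkin_le _ _ _ (ha (j - 1)) (ha j)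
    unfold reduceColors
    omega

/-- Adjacent entries at positions `1, …, n` differ, and position `1` has color `0`. -/
def ProperOn (n : ℤ) (a : ℤ → ℕ) : Prop :=
  a 1 = 0 ∧ ∀ i, 1 ≤ i → i < n → a i ≠ a (i + 1)

theorem reduceColors_properOn {n : ℤ} {a : ℤ → ℕ} (h0 : ∀ i ≤ 1, a i = 0) (ha : ProperOn n a) :
    (∀ i ≤ 1, reduceColors a i = 0) ∧ ProperOn n (reduceColors a) := by
  have h : ∀ i ≤ 1, reduceColors a i = 0 := fun i hi => by
    simp [reduceColors, h0 i hi, h0 (i - 1) (by omega), coleVishkin]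
  refine ⟨h, h 1 le_rfl, fun i h1 hn => ?_⟩
  rw [reduceColors, reduceColors, add_sub_cancel_right]
  exact coleVishkin_ne _ _ _ (ha.2 i h1 hn)

theorem reduceColors_iterate_properOn {n : ℤ} (k : ℕ) {a : ℤ → ℕ} (h0 : ∀ i ≤ 1, a i = 0)
    (ha : ProperOn n a) : ProperOn n (reduceColors^[k] a) := by
  induction k generalizing a with
  | zero => exact ha
  | succ k ih =>
    obtain ⟨h, h'⟩ := reduceColors_properOn h0 ha
    exact ih h h'

/-- The least color different from both `x` and `y`. -/
def freeColor (x y : ℕ) : ℕ :=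
  if x ≠ 0 ∧ y ≠ 0 then 0 else if x ≠ 1 ∧ y ≠ 1 then 1 else 2

theorem freeColor_spec (x y : ℕ) : freeColor x y ≤ 2 ∧ freeColor x y ≠ x ∧ freeColor x y ≠ y := by
  unfold freeColor
  split_ifs <;> omega

/-- Recolor every entry of color `t` with the least color not used by its neighbors. -/
def eliminateColor (t : ℕ) (a : ℤ → ℕ) (i : ℤ) : ℕ :=
  if a i = t then freeColor (a (i - 1)) (a (i + 1)) else a i

theorem eliminateColor_le {t : ℕ} (ht : 2 ≤ t) {a : ℤ → ℕ} (ha : ∀ i, a i ≤ t + 1) (i : ℤ) :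
    eliminateColor (t + 1) a i ≤ t := by
  have := ha i
  have := freeColor_spec (a (i - 1)) (a (i + 1))
  unfold eliminateColor
  split_ifs <;> omega

theorem eliminateColor_properOn {n : ℤ} {t : ℕ} (ht : t ≠ 0) {a : ℤ → ℕ} (ha : ProperOn n a) :
    ProperOn n (eliminateColor t a) := by
  refine ⟨by rw [eliminateColor, if_neg (by rw [ha.1]; exact ht.symm), ha.1], fun i h1 hn => ?_⟩
  have := ha.2 i h1 hn
  have := freeColor_spec (a (i - 1)) (a (i + 1))
  have := freeColor_spec (a i) (a (i + 1 + 1))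
  unfold eliminateColor
  rw [add_sub_cancel_right]
  split_ifs <;> omega

/-- Erase the first entry of each nonzero block. -/
def zeroFirst (q : ℤ → ℕ) (i : ℤ) : ℕ := if q (i - 1) = 0 then 0 else q i

/-- The coloring with colors `0, 1, 2` obtained from a padded sequence by `k` rounds of color
reduction and the elimination of the colors `5, 4, 3`. -/
def threeColoring (k : ℕ) (q : ℤ → ℕ) : ℤ → ℕ :=
  eliminateColor 3 (eliminateColor 4 (eliminateColor 5 (reduceColors^[k] (zeroFirst q))))

/-- Overwrite `c` by `3` outside of the nonzero block of `q` and at its last position. -/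
def maskEnds (q c : ℤ → ℕ) (i : ℤ) : ℕ := if q i = 0 ∨ q (i + 1) = 0 then 3 else c i

/-- The indicator of the strict local minima. -/
def localMin (e : ℤ → ℕ) (i : ℤ) : ℕ := if e i < e (i - 1) ∧ e i < e (i + 1) then 1 else 0

/-- The parsing bits of a padded sequence. -/
def parseBits (k : ℕ) (q : ℤ → ℕ) : ℤ → ℕ := localMin (maskEnds q (threeColoring k q))

/-- The value of `F q` at `i` depends only on the entries of `q` at `i - l, …, i + r`, and not
on the position `i` itself. -/
def IsLocal (l r : ℕ) (F : (ℤ → ℕ) → ℤ → ℕ) : Prop :=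
  ∀ q q' i i', (∀ j : ℤ, -(l : ℤ) ≤ j → j ≤ r → q (i + j) = q' (i' + j)) → F q i = F q' i'

theorem IsLocal.comp {l r l' r' : ℕ} {F G : (ℤ → ℕ) → ℤ → ℕ} (hG : IsLocal l' r' G)
    (hF : IsLocal l r F) : IsLocal (l + l') (r + r') (fun q => G (F q)) := by
  intro q q' i i' h
  refine hG _ _ _ _ fun j h1 h2 => hF _ _ _ _ fun m h3 h4 => ?_
  rw [add_assoc, add_assoc]
  exact h _ (by push_cast; omega) (by push_cast; omega)

theorem isLocal_zeroFirst : IsLocal 1 0 zeroFirst := by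
  intro q q' i i' h
  have h0 := h 0 (by norm_num) (by norm_num)
  have h1 := h (-1) (by norm_num) (by norm_num)
  simp only [add_zero, ← sub_eq_add_neg] at h0 h1
  simp only [zeroFirst, h0, h1]

theorem isLocal_reduceColors : IsLocal 1 0 reduceColors := by
  intro q q' i i' h
  have h0 := h 0 (by norm_num) (by norm_num)
  have h1 := h (-1) (by norm_num) (by norm_num)
  simp only [add_zero, ← sub_eq_add_neg] at h0 h1
  simp only [reduceColors, h0, h1]

theorem isLocal_reduceColors_iterate (k : ℕ) : IsLocal k 0 (reduceColors^[k]) := by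
  induction k with
  | zero =>
    intro q q' i i' h
    simpa using h 0 (by norm_num) (by norm_num)
  | succ k ih =>
    rw [Function.iterate_succ']
    exact isLocal_reduceColors.comp ih

theorem isLocal_eliminateColor (t : ℕ) : IsLocal 1 1 (eliminateColor t) := by
  intro q q' i i' h
  have h0 := h 0 (by norm_num) (by norm_num)
  have h1 := h (-1) (by norm_num) (by norm_num)
  have h2 := h 1 (by norm_num) (by norm_num)
  simp only [add_zero, ← sub_eq_add_neg] at h0 h1
  simp only [eliminateColor, h0, h1, h2]

theorem isLocal_localMin : IsLocal 1 1 localMin := by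
  intro q q' i i' h
  have h0 := h 0 (by norm_num) (by norm_num)
  have h1 := h (-1) (by norm_num) (by norm_num)
  have h2 := h 1 (by norm_num) (by norm_num)
  simp only [add_zero, ← sub_eq_add_neg] at h0 h1
  simp only [localMin, h0, h1, h2]

theorem isLocal_threeColoring (k : ℕ) : IsLocal (k + 4) 3 (threeColoring k) := by
  have h := (isLocal_eliminateColor 3).comp ((isLocal_eliminateColor 4).comp
    ((isLocal_eliminateColor 5).comp ((isLocal_reduceColors_iterate k).comp isLocal_zeroFirst)))
  have e : 1 + k + 1 + 1 + 1 = k + 4 := by omega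
  exact e ▸ h

theorem IsLocal.maskEnds {l r : ℕ} {F : (ℤ → ℕ) → ℤ → ℕ} (hF : IsLocal l (r + 1) F) :
    IsLocal l (r + 1) (fun q => maskEnds q (F q)) := by
  intro q q' i i' h
  have h0 := h 0 (by omega) (by omega)
  have h1 := h 1 (by omega) (by omega)
  simp only [add_zero] at h0
  simp only [_root_.maskEnds, h0, h1, hF q q' i i' h]

theorem isLocal_parseBits (k : ℕ) : IsLocal (k + 5) 4 (parseBits k) :=
  isLocal_localMin.comp (isLocal_threeColoring k).maskEnds

theorem threeColoring_le {W : ℕ} (hW : 1 ≤ W) {q : ℤ → ℕ} (hq : ∀ i, q i ≤ W) (i : ℤ) :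
    threeColoring (logStar W + 1) q i ≤ 2 := by
  refine eliminateColor_le le_rfl (eliminateColor_le (by norm_num)
    (eliminateColor_le (by norm_num) fun j => ?_)) i
  have h7 : ∀ j, (reduceColors^[logStar W] (zeroFirst q)) j ≤ 7 := by
    refine reduceColors_iterate_le W hW _ fun j => ?_
    have := hq j
    unfold zeroFirst
    split_ifs <;> omega
  rw [Function.iterate_succ_apply']
  exact (coleVishkin_le _ _ 7 (h7 _) (h7 _)).trans
    (by rw [Nat.log_eq_of_pow_le_of_lt_pow (m := 2) (by norm_num) (by norm_num)])

theorem threeColoring_properOn (k : ℕ) {n : ℤ} {q : ℤ → ℕ} (h0 : ∀ i ≤ 0, q i = 0)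
    (hpos : ∀ i, 1 ≤ i → i ≤ n → q i ≠ 0) (hne : ∀ i, 1 ≤ i → i < n → q i ≠ q (i + 1)) :
    ProperOn n (threeColoring k q) := by
  have hz : ∀ i ≤ 1, zeroFirst q i = 0 := fun i hi => if_pos (h0 _ (by omega))
  refine eliminateColor_properOn (by norm_num) (eliminateColor_properOn (by norm_num)
    (eliminateColor_properOn (by norm_num) (reduceColors_iterate_properOn k hz
      ⟨hz 1 le_rfl, fun i h1 hn => ?_⟩)))
  have hi := hpos i h1 hn.le
  have hi' := hpos (i + 1) (by omega) (by omega)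
  have := hne i h1 hn
  unfold zeroFirst
  rw [add_sub_cancel_right]
  split_ifs <;> omega

theorem localMin_parsing {n : ℤ} (hn : 2 ≤ n) {e : ℤ → ℕ} (hl : e 0 = 3) (hr : ∀ i, n ≤ i → e i = 3)
    (hle : ∀ i, 1 ≤ i → i < n → e i ≤ 2) (he1 : e 1 = 0)
    (hne : ∀ i, 1 ≤ i → i < n → e i ≠ e (i + 1)) :
    localMin e 1 = 1 ∧ localMin e n = 0 ∧
      (∀ i, localMin e i + localMin e (i + 1) ≤ 1) ∧
      ∀ i, 1 ≤ i → i + 3 ≤ n →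
        1 ≤ localMin e i + localMin e (i + 1) + localMin e (i + 2) + localMin e (i + 3) := by
  have h1 : localMin e 1 = 1 := by
    have := hne 1 le_rfl (by omega)
    exact if_pos ⟨by norm_num [hl, he1], by omega⟩
  refine ⟨h1, ?_, fun i => ?_, fun i hi hin => ?_⟩
  · refine if_neg fun h => ?_
    rw [hr n le_rfl, hr (n + 1) (by omega)] at h
    omega
  · unfold localMin
    rw [add_sub_cancel_right]
    split_ifs <;> omega
  · obtain rfl | hi := hi.eq_or_lt
    · omega
    have a0 := hne (i - 1) (by omega) (by omega)
    have a1 := hne i (by omega) (by omega)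
    have a2 := hne (i + 1) (by omega) (by omega)
    have a3 := hne (i + 2) (by omega) (by omega)
    have b0 := hle (i - 1) (by omega) (by omega)
    have b1 := hle i (by omega) (by omega)
    have b2 := hle (i + 1) (by omega) (by omega)
    have b3 := hle (i + 2) (by omega) (by omega)
    have b4 : i + 3 = n → e (i + 3) = 3 := fun h => hr _ h.ge
    have b5 : i + 3 < n → e (i + 3) ≤ 2 ∧ e (i + 3) ≠ e (i + 4) := fun h =>
      ⟨hle _ (by omega) h, by simpa [add_assoc] using hne (i + 3) (by omega) h⟩
    have s1 : i + 1 - 1 = i := by ring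
    have s2 : i + 2 - 1 = i + 1 := by ring
    have s3 : i + 3 - 1 = i + 2 := by ring
    have t0 : i - 1 + 1 = i := by ring
    have t1 : i + 1 + 1 = i + 2 := by ring
    have t2 : i + 2 + 1 = i + 3 := by ring
    have t3 : i + 3 + 1 = i + 4 := by ring
    simp only [localMin, s1, s2, s3, t0, t1, t2, t3] at *
    split_ifs <;> omega

/-- **locally consistent parsing, Mehlhorn et al..** For every positive
integer `W` there is a function `f` from `(log* W + 11)`-tuples over `[0..W]` to `{0,1}`
such that for every `W`-colored sequence `p` of length `n ≥ 2` (values in `{1,…,W}`,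
adjacent values distinct), the bit sequence `d` defined by
`d(i) = f(p̃(i−Δ_L), …, p̃(i+Δ_R))` with `Δ_L = log* W + 6`, `Δ_R = 4` and `p̃` the
`0`-padded extension of `p`, satisfies the four locally consistent parsing conditions. -/
theorem locally_consistent_parsing_exists (W : ℕ) (hW : 1 ≤ W) :
    ∃ f : (Fin (logStar W + 11) → ℕ) → ℕ,
      (∀ v, (∀ t, v t ≤ W) → f v ≤ 1) ∧
      ∀ (n : ℕ), 2 ≤ n →
      ∀ p : ℤ → ℕ,
        (∀ i : ℤ, 1 ≤ i → i ≤ (n : ℤ) → 1 ≤ p i ∧ p i ≤ W) →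
        (∀ i : ℤ, 1 ≤ i → i < (n : ℤ) → p i ≠ p (i + 1)) →
      ∀ ptilde : ℤ → ℕ,
        (∀ m : ℤ, ptilde m = if 1 ≤ m ∧ m ≤ (n : ℤ) then p m else 0) →
      ∀ d : ℤ → ℕ,
        (∀ m : ℤ, d m =
          f (fun t => ptilde (m - ((logStar W + 6 : ℕ) : ℤ) + ((t : ℕ) : ℤ)))) →
        d 1 = 1 ∧ d (n : ℤ) = 0 ∧
        (∀ i : ℤ, 1 ≤ i → i < (n : ℤ) → d i + d (i + 1) ≤ 1) ∧
        (∀ i : ℤ, 1 ≤ i → i + 3 ≤ (n : ℤ) →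
          1 ≤ d i + d (i + 1) + d (i + 2) + d (i + 3)) := by
  refine ⟨fun v => parseBits (logStar W + 1)
    (fun z => if h : 0 ≤ z ∧ z < ((logStar W + 11 : ℕ) : ℤ) then v ⟨z.toNat, by omega⟩ else 0)
    ((logStar W + 6 : ℕ) : ℤ), fun v _ => ?_, ?_⟩
  · simp only [parseBits, localMin]
    split_ifs <;> omega
  intro n hn p hp hne q hq d hd
  have hdq : d = parseBits (logStar W + 1) q := by
    funext m
    rw [hd]
    refine isLocal_parseBits _ _ _ _ _ fun j h1 h2 => ?_
    push_cast at h1 h2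
    rw [dif_pos ⟨by push_cast; omega, by push_cast; omega⟩]
    refine congrArg q ?_
    push_cast
    omega
  have hqW : ∀ i, q i ≤ W := fun i => by
    rw [hq]
    split_ifs with h
    · exact (hp i h.1 h.2).2
    · exact Nat.zero_le _
  have hq0 : ∀ i, ¬(1 ≤ i ∧ i ≤ (n : ℤ)) → q i = 0 := fun i h => by rw [hq, if_neg h]
  have hqp : ∀ i, 1 ≤ i → i ≤ (n : ℤ) → q i = p i := fun i h h' => by rw [hq, if_pos ⟨h, h'⟩]
  have hpos : ∀ i, 1 ≤ i → i ≤ (n : ℤ) → q i ≠ 0 := fun i h h' => by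
    have := hp i h h'
    rw [hqp i h h']
    omega
  obtain ⟨hc1, hc⟩ := threeColoring_properOn (logStar W + 1) (fun i hi => hq0 i (by omega)) hpos
    fun i h1 h2 => by
      rw [hqp i h1 h2.le, hqp (i + 1) (by omega) (by omega)]
      exact hne i h1 h2
  have hcW := threeColoring_le hW hqW
  have hin : ∀ i, 1 ≤ i → i < (n : ℤ) →
      maskEnds q (threeColoring (logStar W + 1) q) i = threeColoring (logStar W + 1) q i :=
    fun i h1 h2 => if_neg (not_or.2 ⟨hpos i h1 h2.le, hpos (i + 1) (by omega) (by omega)⟩)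
  have hout : ∀ i, (n : ℤ) ≤ i → maskEnds q (threeColoring (logStar W + 1) q) i = 3 :=
    fun i hi => if_pos (Or.inr (hq0 _ (by omega)))
  obtain ⟨r1, r2, r3, r4⟩ := localMin_parsing (n := n) (by omega)
    (e := maskEnds q (threeColoring (logStar W + 1) q)) (if_pos (Or.inl (hq0 0 (by omega)))) hout
    (fun i h1 h2 => (hin i h1 h2).trans_le (hcW i)) ((hin 1 le_rfl (by omega)).trans hc1)
    fun i h1 h2 => by
      rw [hin i h1 h2]
      obtain h | h := (show i + 1 ≤ (n : ℤ) by omega).eq_or_lt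
      · have := hcW i
        rw [hout (i + 1) h.ge]
        omega
      · rw [hin (i + 1) (by omega) h]
        exact hc i h1 h2
  rw [hdq]
  exact ⟨r1, r2, fun i _ _ => r3 i, r4⟩
end

section
/- For natural numbers x ≠ y, let i(x,y) be the least bit position at which the binary representations of x and y differ, and define the label ℓ(x,y) = 2·i(x,y) + bit_{i(x,y)}(y), where bit_i(y) ∈ {0,1} is the i-th binary digit of y. Then: (a) for all natural numbers x, y, z with x ≠ y and y ≠ z, ℓ(x,y) ≠ ℓ(y,z); and (b) if moreover 0 ≤ x, y ≤ W with W ≥ 1, then ℓ(x,y) ≤ 2·⌊log₂ W⌋ + 1. Consequently, applying ℓ to consecutive pairs of a W-colored sequence yields a (2⌊log₂ W⌋+2)-colored sequence (adjacent values remain distinct), where the new value at each position depends only on the previous and current values of the original sequence. -/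
/-- The least bit position at which the binary representations of `x` and `y` differ
(defined as the infimum of the set of differing bit positions). -/
noncomputable def diffBit (x y : ℕ) : ℕ := sInf {i | x.testBit i ≠ y.testBit i}

/-- The deterministic coin tossing label `ℓ(x,y) = 2·i(x,y) + bit_{i(x,y)}(y)`. -/
noncomputable def dctLabel (x y : ℕ) : ℕ :=
  2 * diffBit x y + (if y.testBit (diffBit x y) then 1 else 0)

theorem testBit_diffBit_ne {x y : ℕ} (h : x ≠ y) :
    x.testBit (diffBit x y) ≠ y.testBit (diffBit x y) :=
  Nat.sInf_mem (s := {i | x.testBit i ≠ y.testBit i}) (Nat.exists_testBit_ne_of_ne h)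

theorem diffBit_le_log {W x y : ℕ} (h : x ≠ y) (hx : x ≤ W) (hy : y ≤ W) :
    diffBit x y ≤ Nat.log 2 W := by
  by_contra! hlt
  have hW : W < 2 ^ diffBit x y := Nat.lt_pow_of_log_lt one_lt_two hlt
  apply testBit_diffBit_ne h
  rw [Nat.testBit_lt_two_pow (hx.trans_lt hW), Nat.testBit_lt_two_pow (hy.trans_lt hW)]

/-- (a) For `x ≠ y` and `y ≠ z` the labels of consecutive pairs differ:
`ℓ(x,y) ≠ ℓ(y,z)`.  (b) If moreover `x, y ≤ W` with `W ≥ 1`, then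
`ℓ(x,y) ≤ 2⌊log₂ W⌋ + 1`.  Hence one color-reduction step of deterministic coin tossing
turns a `W`-colored sequence into a `(2⌊log₂ W⌋ + 2)`-colored sequence. -/
theorem dctLabel_step :
    (∀ x y z : ℕ, x ≠ y → y ≠ z → dctLabel x y ≠ dctLabel y z) ∧
    (∀ W x y : ℕ, 1 ≤ W → x ≠ y → x ≤ W → y ≤ W →
      dctLabel x y ≤ 2 * Nat.log 2 W + 1) := by
  refine ⟨fun x y z _ hyz heq => ?_, fun W x y _ hxy hx hy => ?_⟩
  · unfold dctLabel at heq
    have hi : diffBit x y = diffBit y z := by split_ifs at heq <;> omega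
    rw [hi] at heq
    have hb : y.testBit (diffBit y z) = z.testBit (diffBit y z) := by
      split_ifs at heq <;> first | omega | simp_all
    exact testBit_diffBit_ne hyz hb
  · have h := diffBit_le_log hxy hx hy
    unfold dctLabel
    split_ifs <;> omega
end

section
/- There exists a function g : [0..6]^7 → {0,1} such that for every n ≥ 2 and every sequence p : {1,…,n} → {1,…,6} with p(i) ≠ p(i+1) for all 1 ≤ i < n, the bit sequence d defined by d(i) = g(p̃(i−3), …, p̃(i+3)) for 1 ≤ i ≤ n—where p̃(m) = p(m) for 1 ≤ m ≤ n and p̃(m) = 0 otherwise—satisfies: d(1) = 1; d(n) = 0; d(i) + d(i+1) ≤ 1 for all 1 ≤ i < n; and d(i) + d(i+1) + d(i+2) + d(i+3) ≥ 1 for all 1 ≤ i ≤ n−3. -/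
/-- The ascent bit of two consecutive padded colors. The end of the sequence counts as an ascent, as
if the padding right after the last position were larger than every color. -/
def ascends (a b : ℕ) : Bool := decide (a < b ∨ (b = 0 ∧ a ≠ 0))

/-- The local rule, in terms of which neighbors of the center are padding (`z k`) and of the ascent
bits (`u k`, comparing the entries `k` and `k + 1` of the window, whose center is entry `3`).
The first position is selected, the second and the last one are not. Elsewhere the rule selects
local maxima, local minima not adjacent to a local maximum, and one further position in every
long monotone run. -/
def selects (z0 z1 z2 z4 z5 z6 u0 u1 u2 u3 u4 u5 : Bool) : Bool :=
  !z4 && (z2 || !z1 &&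
    (u2 && !u3
      || !u2 && u3 && u4 && (!u1 || z0)
      || u0 && !u1 && !u2 && !u3 && !u4
      || z0 && u1 && !u2 && !u3 && !u4 && u5
      || u1 && u2 && u3 && u4 && (if z5 then !u0 else z6 || !u5)))

/-- The local rule as a function of the seven padded colors in the window. -/
def windowRule (v : Fin 7 → ℕ) : ℕ :=
  (selects (v 0 == 0) (v 1 == 0) (v 2 == 0) (v 4 == 0) (v 5 == 0) (v 6 == 0)
    (ascends (v 0) (v 1)) (ascends (v 1) (v 2)) (ascends (v 2) (v 3))
    (ascends (v 3) (v 4)) (ascends (v 4) (v 5)) (ascends (v 5) (v 6))).toNat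

set_option synthInstance.maxSize 4000 in
theorem selects_not_adjacent :
    ∀ z0 z1 : Bool, (z1 → z0) → ∀ z2 : Bool, (z2 → z1) →
    ∀ z5 z6 : Bool, (z5 → z6) → ∀ z7 : Bool, (z6 → z7) →
    ∀ u0 : Bool, (z0 ≠ z1 → u0) → ∀ u1 : Bool, (z1 ≠ z2 → u1) →
    ∀ u2 : Bool, (z2 → u2) → ∀ u3 u4 : Bool, (z5 → u4) →
    ∀ u5 : Bool, (z5 ≠ z6 → u5) → ∀ u6 : Bool, (z6 ≠ z7 → u6) →
      (selects z0 z1 z2 false z5 z6 u0 u1 u2 u3 u4 u5).toNat +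
        (selects z1 z2 false z5 z6 z7 u1 u2 u3 u4 u5 u6).toNat ≤ 1 := by
  decide +kernel

/-- Seven consecutive colors are neither strictly increasing nor strictly decreasing. -/
def NotMonotone (z z' u0 u1 u2 u3 u4 u5 : Bool) : Prop :=
  z = false → z' = false →
    (u0 && u1 && u2 && u3 && u4 && u5) = false ∧ (u0 || u1 || u2 || u3 || u4 || u5) = true

instance (z z' u0 u1 u2 u3 u4 u5 : Bool) : Decidable (NotMonotone z z' u0 u1 u2 u3 u4 u5) := by
  unfold NotMonotone; infer_instance

set_option synthInstance.maxSize 4000 in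
theorem selects_of_four :
    ∀ z0 z1 : Bool, (z1 → z0) → ∀ z2 : Bool, (z2 → z1) →
    ∀ z7 z8 : Bool, (z7 → z8) → ∀ z9 : Bool, (z8 → z9) →
    ∀ u0 : Bool, (z0 ≠ z1 → u0) → ∀ u1 : Bool, (z1 ≠ z2 → u1) →
    ∀ u2 : Bool, (z2 → u2) → ∀ u3 u4 u5 : Bool, NotMonotone z0 false u0 u1 u2 u3 u4 u5 →
    ∀ u6 : Bool, (z7 → u6) → NotMonotone z1 z7 u1 u2 u3 u4 u5 u6 →
    ∀ u7 : Bool, (z7 ≠ z8 → u7) → NotMonotone z2 z8 u2 u3 u4 u5 u6 u7 →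
    ∀ u8 : Bool, (z8 ≠ z9 → u8) → NotMonotone false z9 u3 u4 u5 u6 u7 u8 →
      1 ≤ (selects z0 z1 z2 false false false u0 u1 u2 u3 u4 u5).toNat +
        (selects z1 z2 false false false z7 u1 u2 u3 u4 u5 u6).toNat +
        (selects z2 false false false z7 z8 u2 u3 u4 u5 u6 u7).toNat +
        (selects false false false z7 z8 z9 u3 u4 u5 u6 u7 u8).toNat := by
  decide +kernel


/-- There is a local rule `g` looking at a window of radius `3`
(so at `7` consecutive padded values in `[0..6]`) such that for every `6`-colored
sequence `p` of length `n ≥ 2` (values in `{1,…,6}`, adjacent values distinct), the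
bit sequence `d(i) = g(p̃(i−3), …, p̃(i+3))`, where `p̃` is the `0`-padded extension
of `p`, satisfies the four locally consistent parsing conditions. -/
theorem base_case_locally_consistent_parsing :
    ∃ g : (Fin 7 → ℕ) → ℕ,
      (∀ v, (∀ t, v t ≤ 6) → g v ≤ 1) ∧
      ∀ (n : ℕ), 2 ≤ n →
      ∀ p : ℤ → ℕ,
        (∀ i : ℤ, 1 ≤ i → i ≤ (n : ℤ) → 1 ≤ p i ∧ p i ≤ 6) →
        (∀ i : ℤ, 1 ≤ i → i < (n : ℤ) → p i ≠ p (i + 1)) →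
      ∀ ptilde : ℤ → ℕ,
        (∀ m : ℤ, ptilde m = if 1 ≤ m ∧ m ≤ (n : ℤ) then p m else 0) →
      ∀ d : ℤ → ℕ,
        (∀ m : ℤ, d m = g (fun t => ptilde (m - 3 + ((t : ℕ) : ℤ)))) →
        d 1 = 1 ∧ d (n : ℤ) = 0 ∧
        (∀ i : ℤ, 1 ≤ i → i < (n : ℤ) → d i + d (i + 1) ≤ 1) ∧
        (∀ i : ℤ, 1 ≤ i → i + 3 ≤ (n : ℤ) →
          1 ≤ d i + d (i + 1) + d (i + 2) + d (i + 3)) := by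
  refine ⟨windowRule, fun v _ => Bool.toNat_le _, ?_⟩
  intro n hn p hp hne q hq d hd
  have hrule : ∀ m, d m = (selects (q (m - 3) == 0) (q (m - 2) == 0) (q (m - 1) == 0)
      (q (m + 1) == 0) (q (m + 2) == 0) (q (m + 3) == 0)
      (ascends (q (m - 3)) (q (m - 2))) (ascends (q (m - 2)) (q (m - 1)))
      (ascends (q (m - 1)) (q m)) (ascends (q m) (q (m + 1)))
      (ascends (q (m + 1)) (q (m + 2))) (ascends (q (m + 2)) (q (m + 3)))).toNat := by
    intro m
    rw [hd]
    have e1 : m - 3 + 1 = m - 2 := by ring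
    have e2 : m - 3 + 2 = m - 1 := by ring
    have e3 : m - 3 + 3 = m := by ring
    have e4 : m - 3 + 4 = m + 1 := by ring
    have e5 : m - 3 + 5 = m + 2 := by ring
    have e6 : m - 3 + 6 = m + 3 := by ring
    simp [windowRule, e1, e2, e3, e4, e5, e6]
  have hin : ∀ m : ℤ, 1 ≤ m → m ≤ n → 1 ≤ q m ∧ q m ≤ 6 := by
    intro m h1 h2
    rw [hq, if_pos ⟨h1, h2⟩]
    exact hp m h1 h2
  have hout : ∀ m : ℤ, m < 1 ∨ n < m → q m = 0 := by
    intro m h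
    rw [hq, if_neg (by omega)]
  have hqne : ∀ m m' : ℤ, m' = m + 1 → 1 ≤ m → m < n → q m ≠ q m' := by
    rintro m _ rfl h1 h2
    rw [hq, hq, if_pos ⟨h1, h2.le⟩, if_pos (by omega)]
    exact hne m h1 h2
  have hpos : ∀ m : ℤ, 1 ≤ m → m ≤ n → (q m == 0) = false := by
    intro m h1 h2
    have := hin m h1 h2
    simp; omega
  have hmem : ∀ m : ℤ, (q m == 0) = false → 1 ≤ m ∧ m ≤ n := by
    intro m h
    by_contra hm
    simp [hout m (by omega)] at h
  have hleft : ∀ m m' : ℤ, m' = m + 1 → m < n → (q m' == 0) = true → (q m == 0) = true := by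
    rintro m _ rfl hm h
    by_contra h0
    have := hmem m (by simpa using h0)
    simp [hpos (m + 1) (by omega) (by omega)] at h
  have hright : ∀ m m' : ℤ, m' = m + 1 → 1 ≤ m → (q m == 0) = true → (q m' == 0) = true := by
    rintro m _ rfl hm h
    by_contra h0
    have := hmem (m + 1) (by simpa using h0)
    simp [hpos m (by omega) (by omega)] at h
  have hedge : ∀ m m' : ℤ, (q m == 0) ≠ (q m' == 0) → ascends (q m) (q m') = true := by
    intro m m' h
    simp only [ascends, decide_eq_true_eq]
    rw [Ne, Bool.eq_iff_iff, beq_iff_eq, beq_iff_eq] at h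
    omega
  have hmono : ∀ m0 m1 m2 m3 m4 m5 m6 : ℤ, m1 = m0 + 1 → m2 = m1 + 1 → m3 = m2 + 1 →
      m4 = m3 + 1 → m5 = m4 + 1 → m6 = m5 + 1 → NotMonotone (q m0 == 0) (q m6 == 0)
      (ascends (q m0) (q m1)) (ascends (q m1) (q m2)) (ascends (q m2) (q m3))
      (ascends (q m3) (q m4)) (ascends (q m4) (q m5)) (ascends (q m5) (q m6)) := by
    intro m0 m1 m2 m3 m4 m5 m6 h1 h2 h3 h4 h5 h6 hz hz'
    have b0 := hmem m0 hz
    have b6 := hmem m6 hz'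
    have r0 := hin m0 (by omega) (by omega)
    have r1 := hin m1 (by omega) (by omega)
    have r2 := hin m2 (by omega) (by omega)
    have r3 := hin m3 (by omega) (by omega)
    have r4 := hin m4 (by omega) (by omega)
    have r5 := hin m5 (by omega) (by omega)
    have r6 := hin m6 (by omega) (by omega)
    have n0 := hqne m0 m1 h1 (by omega) (by omega)
    have n1 := hqne m1 m2 h2 (by omega) (by omega)
    have n2 := hqne m2 m3 h3 (by omega) (by omega)
    have n3 := hqne m3 m4 h4 (by omega) (by omega)
    have n4 := hqne m4 m5 h5 (by omega) (by omega)
    have n5 := hqne m5 m6 h6 (by omega) (by omega)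
    clear hz hz' hrule hd hq hp hne hin hout hqne hpos hmem hleft hright hedge
    constructor
    · by_contra h
      simp only [ascends, Bool.not_eq_false, Bool.and_eq_true, decide_eq_true_eq] at h
      omega
    · by_contra h
      simp only [ascends, Bool.not_eq_true, Bool.or_eq_false_iff, decide_eq_false_iff_not] at h
      omega
  refine ⟨?_, ?_, ?_, ?_⟩
  · rw [hrule, hout (1 - 1) (by omega), hpos (1 + 1) (by omega) (by omega)]
    simp [selects]
  · rw [hrule, hout (n + 1) (by omega)]
    simp [selects]
  · intro i h1 h2
    have e1 : i + 1 - 3 = i - 2 := by ring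
    have e2 : i + 1 - 2 = i - 1 := by ring
    have e3 : i + 1 - 1 = i := by ring
    have e4 : i + 1 + 1 = i + 2 := by ring
    have e5 : i + 1 + 2 = i + 3 := by ring
    have e6 : i + 1 + 3 = i + 4 := by ring
    have z3 := hpos i (by omega) (by omega)
    have z4 := hpos (i + 1) (by omega) (by omega)
    rw [hrule i, hrule (i + 1), e1, e2, e3, e4, e5, e6, z3, z4]
    exact selects_not_adjacent _ _ (hleft _ _ (by ring) (by omega))
      _ (hleft _ _ (by ring) (by omega)) _ _ (hright _ _ (by ring) (by omega))
      _ (hright _ _ (by ring) (by omega)) _ (hedge _ _) _ (hedge _ _)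
      _ (fun h => hedge _ _ (by simp [h, z3])) _ _ (fun h => hedge _ _ (by simp [h, z4]))
      _ (hedge _ _) _ (hedge _ _)
  · intro i h1 h2
    have e1 : i + 1 - 3 = i - 2 := by ring
    have e2 : i + 1 - 2 = i - 1 := by ring
    have e3 : i + 1 - 1 = i := by ring
    have e4 : i + 1 + 1 = i + 2 := by ring
    have e5 : i + 1 + 2 = i + 3 := by ring
    have e6 : i + 1 + 3 = i + 4 := by ring
    have f1 : i + 2 - 3 = i - 1 := by ring
    have f2 : i + 2 - 2 = i := by ring
    have f3 : i + 2 - 1 = i + 1 := by ring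
    have f4 : i + 2 + 1 = i + 3 := by ring
    have f5 : i + 2 + 2 = i + 4 := by ring
    have f6 : i + 2 + 3 = i + 5 := by ring
    have g1 : i + 3 - 3 = i := by ring
    have g2 : i + 3 - 2 = i + 1 := by ring
    have g3 : i + 3 - 1 = i + 2 := by ring
    have g4 : i + 3 + 1 = i + 4 := by ring
    have g5 : i + 3 + 2 = i + 5 := by ring
    have g6 : i + 3 + 3 = i + 6 := by ring
    have z3 := hpos i (by omega) (by omega)
    have z4 := hpos (i + 1) (by omega) (by omega)
    have z5 := hpos (i + 2) (by omega) (by omega)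
    have z6 := hpos (i + 3) (by omega) (by omega)
    rw [hrule i, hrule (i + 1), hrule (i + 2), hrule (i + 3), e1, e2, e3, e4, e5, e6,
      f1, f2, f3, f4, f5, f6, g1, g2, g3, g4, g5, g6, z3, z4, z5, z6]
    exact selects_of_four _ _ (hleft _ _ (by ring) (by omega))
      _ (hleft _ _ (by ring) (by omega)) _ _ (hright _ _ (by ring) (by omega))
      _ (hright _ _ (by ring) (by omega)) _ (hedge _ _) _ (hedge _ _)
      _ (fun h => hedge _ _ (by simp [h, z3])) _ _ _
      (z6 ▸ hmono _ _ _ _ _ _ _ (by ring) (by ring) (by ring) (by ring) (by ring) (by ring))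
      _ (fun h => hedge _ _ (by simp [h, z6]))
      (hmono _ _ _ _ _ _ _ (by ring) (by ring) (by ring) (by ring) (by ring) (by ring))
      _ (hedge _ _)
      (hmono _ _ _ _ _ _ _ (by ring) (by ring) (by ring) (by ring) (by ring) (by ring))
      _ (hedge _ _)
      (z3 ▸ hmono _ _ _ _ _ _ _ (by ring) (by ring) (by ring) (by ring) (by ring) (by ring))
end
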